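/- Suppose that liminf_{|x|→∞} [ inf_{z: |x|−1 ≤ |z| ≤ |x|−1/2} e^{−V(z)} ] / [ sup_{z: |x| ≤ |z| ≤ |x|+1} e^{−V(z)} ] > (1/α)·2^{2d+1}·(e + e^{1/2})·(2^α − 1). Then there exists a constant C₁ > 0 such that for every f ∈ C_b^∞(ℝ^d) with μ_V(f) = 0 one has μ_V(f²) ≤ C₁ · 𝓔_{α,V}(f,f) (the Poincaré inequality). -/

import Mathlib

open MeasureTheory Real Set Metric Filter

noncomputable section

/-- Euclidean space `ℝ^d`. -/
abbrev Ed (d : ℕ) := EuclideanSpace ℝ (Fin d)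

/-- The probability measure `μ_V(dx) = C_V e^{-V(x)} dx` with `C_V = (∫ e^{-V})⁻¹`. -/
def muV (d : ℕ) (V : Ed d → ℝ) : Measure (Ed d) :=
  (volume : Measure (Ed d)).withDensity
    fun x => ENNReal.ofReal ((∫ y, Real.exp (-V y))⁻¹ * Real.exp (-V x))

/-- `f ∈ C_b^∞(ℝ^d)`: smooth with bounded derivatives of every order. -/
def CbSmooth (d : ℕ) (f : Ed d → ℝ) : Prop :=
  ContDiff ℝ (⊤ : ℕ∞) f ∧ ∀ n : ℕ, ∃ C : ℝ, ∀ x, ‖iteratedFDeriv ℝ n f x‖ ≤ C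

/-- `V` is locally bounded. -/
def LocallyBounded (d : ℕ) (V : Ed d → ℝ) : Prop :=
  ∀ r : ℝ, ∃ M : ℝ, ∀ x : Ed d, ‖x‖ ≤ r → |V x| ≤ M

/-- The nonlocal Dirichlet form with finite range jumps `𝓔_{α,V}`. -/
def formE (d : ℕ) (α : ℝ) (V f : Ed d → ℝ) : ℝ :=
  (1/2) * ∫ x, (∫ y in {y : Ed d | dist x y ≤ 1},
      (f x - f y) ^ 2 / dist x y ^ ((d : ℝ) + α)) ∂(muV d V)

/-- The nonlocal Dirichlet form with large jumps `𝓓_{α,V}`. -/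
def formD (d : ℕ) (α : ℝ) (V f : Ed d → ℝ) : ℝ :=
  (1/2) * ∫ x, (∫ y in {y : Ed d | 1 < dist x y},
      (f x - f y) ^ 2 / dist x y ^ ((d : ℝ) + α)) ∂(muV d V)

/-- `inf_{z : |x|-1 ≤ |z| ≤ |x|-1/2} e^{-V(z)}`. -/
def infAnn (d : ℕ) (V : Ed d → ℝ) (x : Ed d) : ℝ :=
  sInf ((fun z => Real.exp (-V z)) '' {z : Ed d | ‖x‖ - 1 ≤ ‖z‖ ∧ ‖z‖ ≤ ‖x‖ - 1/2})

/-- `sup_{z : |x| ≤ |z| ≤ |x|+1} e^{-V(z)}`. -/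
def supAnn (d : ℕ) (V : Ed d → ℝ) (x : Ed d) : ℝ :=
  sSup ((fun z => Real.exp (-V z)) '' {z : Ed d | ‖x‖ ≤ ‖z‖ ∧ ‖z‖ ≤ ‖x‖ + 1})

/-- `K(r) = sup_{|x| ≤ r} e^{-V(x)}`. -/
def Kfun (d : ℕ) (V : Ed d → ℝ) (r : ℝ) : ℝ :=
  sSup ((fun x => Real.exp (-V x)) '' {x : Ed d | ‖x‖ ≤ r})

/-- `k(r) = inf_{|x| ≤ r+1} e^{-V(x)}`. -/
def kfun (d : ℕ) (V : Ed d → ℝ) (r : ℝ) : ℝ :=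
  sInf ((fun x => Real.exp (-V x)) '' {x : Ed d | ‖x‖ ≤ r + 1})

/-- The constant `(1/α)·2^{2d+1}·(e + e^{1/2})·(2^α − 1)`. -/
def thresholdConst (d : ℕ) (α : ℝ) : ℝ :=
  (1/α) * (2:ℝ) ^ (2*d+1) * (Real.exp 1 + Real.exp (1/2)) * ((2:ℝ) ^ α - 1)

lemma ofReal_sub_sq_le (a b m : ℝ) :
    ENNReal.ofReal ((a - b) ^ 2) ≤
      2 * ENNReal.ofReal ((a - m) ^ 2) + 2 * ENNReal.ofReal ((b - m) ^ 2) := by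
  rw [← ENNReal.ofReal_ofNat 2, ← ENNReal.ofReal_mul (by norm_num),
    ← ENNReal.ofReal_mul (by norm_num), ← ENNReal.ofReal_add (by positivity) (by positivity)]
  apply ENNReal.ofReal_le_ofReal
  nlinarith [sq_nonneg ((a - m) + (b - m))]

open scoped ENNReal in
lemma measurable_setLIntegral_closedBall {d : ℕ} {h : Ed d × Ed d → ℝ≥0∞} (hh : Measurable h)
    (r : ℝ) : Measurable fun x : Ed d => ∫⁻ y in closedBall x r, h (x, y) := by
  have hm : MeasurableSet {q : Ed d × Ed d | dist q.2 q.1 ≤ r} :=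
    measurableSet_le (by fun_prop) (by fun_prop)
  convert (hh.indicator hm).lintegral_prod_right' (ν := (volume : Measure (Ed d))) using 2 with x
  rw [← lintegral_indicator measurableSet_closedBall]
  rfl

open scoped ENNReal in
/-- Far from the origin, mass is controlled by the mass in an inner annulus and the energy. -/
lemma tail_lintegral_le {d : ℕ} (G : Ed d → ℝ≥0∞) (hG : Measurable G) (u : Ed d → ℝ)
    (hu : Measurable u) (k : ℝ≥0∞) (R : ℝ) (hR : 1 ≤ R)
    (hk : ∀ x, R ≤ ‖x‖ → ∀ z, ‖x‖ - 1 ≤ ‖z‖ → ‖z‖ ≤ ‖x‖ - 1/2 → k * G x ≤ G z) :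
    k * volume (closedBall (0 : Ed d) (1/4)) *
        ∫⁻ x in {x | R ≤ ‖x‖}, ENNReal.ofReal (u x ^ 2) * G x ≤
      2 * volume (closedBall (0 : Ed d) 1) * (∫⁻ x, ENNReal.ofReal (u x ^ 2) * G x) +
      2 * k * ∫⁻ x, (∫⁻ y in closedBall x 1, ENNReal.ofReal ((u x - u y) ^ 2)) * G x := by
  have hpt : ∀ x ∈ {x : Ed d | R ≤ ‖x‖},
      k * volume (closedBall (0 : Ed d) (1/4)) * (ENNReal.ofReal (u x ^ 2) * G x) ≤
      2 * (∫⁻ z in closedBall x 1, ENNReal.ofReal (u z ^ 2) * G z) +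
      2 * k * ((∫⁻ y in closedBall x 1, ENNReal.ofReal ((u x - u y) ^ 2)) * G x) := by
    intro x hx
    have hx' : R ≤ ‖x‖ := hx
    have hpos : 0 < ‖x‖ := by linarith
    set p : Ed d := (1 - 3 / (4 * ‖x‖)) • x with hp
    have hxp : dist x p = 3/4 := by
      have : x - p = (3 / (4 * ‖x‖)) • x := by rw [hp]; module
      rw [dist_eq_norm, this, norm_smul, Real.norm_eq_abs, abs_of_pos (by positivity)]
      field_simp
    have hpn : ‖p‖ = ‖x‖ - 3/4 := by
      rw [hp, norm_smul, Real.norm_eq_abs, abs_of_nonneg]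
      · field_simp
      · rw [sub_nonneg, div_le_one (by positivity)]; linarith
    have hsub : closedBall p (1/4) ⊆ closedBall x 1 := by
      intro z hz
      rw [mem_closedBall] at hz ⊢
      have := dist_triangle z p x
      rw [dist_comm p x] at this
      linarith
    have hGz : ∀ z ∈ closedBall p (1/4), k * G x ≤ G z := by
      intro z hz
      rw [mem_closedBall, dist_eq_norm] at hz
      have h1 := norm_sub_norm_le z p
      have h2 := norm_sub_norm_le p z
      rw [norm_sub_rev p z] at h2
      exact hk x hx' z (by linarith) (by linarith)
    have hvol : volume (closedBall (0 : Ed d) (1/4)) = volume (closedBall p (1/4)) :=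
      (Measure.addHaar_closedBall_center volume p (1/4)).symm
    calc k * volume (closedBall (0 : Ed d) (1/4)) * (ENNReal.ofReal (u x ^ 2) * G x)
        = ∫⁻ _z in closedBall p (1/4), k * (ENNReal.ofReal (u x ^ 2) * G x) := by
          rw [setLIntegral_const, hvol]; ring
      _ ≤ ∫⁻ z in closedBall p (1/4), (2 * (ENNReal.ofReal (u z ^ 2) * G z) +
            2 * k * G x * ENNReal.ofReal ((u x - u z) ^ 2)) := by
          refine setLIntegral_mono' measurableSet_closedBall fun z hz => ?_
          have h1 : ENNReal.ofReal (u x ^ 2) ≤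
              2 * ENNReal.ofReal (u z ^ 2) + 2 * ENNReal.ofReal ((u x - u z) ^ 2) := by
            simpa using ofReal_sub_sq_le (u x) 0 (u z) |>.trans_eq (add_comm _ _)
          calc k * (ENNReal.ofReal (u x ^ 2) * G x)
              ≤ k * ((2 * ENNReal.ofReal (u z ^ 2) + 2 * ENNReal.ofReal ((u x - u z) ^ 2)) * G x) := by
                gcongr
            _ = 2 * (ENNReal.ofReal (u z ^ 2) * (k * G x)) +
                  2 * k * G x * ENNReal.ofReal ((u x - u z) ^ 2) := by ring
            _ ≤ _ := by gcongr; exact hGz z hz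
      _ ≤ ∫⁻ z in closedBall x 1, (2 * (ENNReal.ofReal (u z ^ 2) * G z) +
            2 * k * G x * ENNReal.ofReal ((u x - u z) ^ 2)) := lintegral_mono_set hsub
      _ = _ := by
          rw [lintegral_add_left (by fun_prop), lintegral_const_mul _ (by fun_prop),
            lintegral_const_mul _ (by fun_prop)]
          ring
  have hswap : ∫⁻ x, ∫⁻ z in closedBall x 1, ENNReal.ofReal (u z ^ 2) * G z =
      volume (closedBall (0 : Ed d) 1) * ∫⁻ x, ENNReal.ofReal (u x ^ 2) * G x := by
    have hm : MeasurableSet {q : Ed d × Ed d | dist q.2 q.1 ≤ 1} :=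
      measurableSet_le (by fun_prop) (by fun_prop)
    have e1 : ∀ x : Ed d, ∫⁻ z in closedBall x 1, ENNReal.ofReal (u z ^ 2) * G z =
        ∫⁻ z, {q : Ed d × Ed d | dist q.2 q.1 ≤ 1}.indicator
          (fun q => ENNReal.ofReal (u q.2 ^ 2) * G q.2) (x, z) := by
      intro x
      rw [← lintegral_indicator measurableSet_closedBall]
      rfl
    simp_rw [e1]
    rw [lintegral_lintegral_swap, ← lintegral_const_mul _ (by fun_prop)]
    · refine lintegral_congr fun z => ?_
      have : ∀ x : Ed d, {q : Ed d × Ed d | dist q.2 q.1 ≤ 1}.indicator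
          (fun q => ENNReal.ofReal (u q.2 ^ 2) * G q.2) (x, z) =
          (closedBall z 1).indicator (fun _ => ENNReal.ofReal (u z ^ 2) * G z) x := by
        intro x
        simp only [indicator, mem_ofPred_eq, mem_closedBall, dist_comm z x]
      simp_rw [this]
      rw [lintegral_indicator measurableSet_closedBall, setLIntegral_const,
        Measure.addHaar_closedBall_center volume z 1, mul_comm]
    · exact (Measurable.indicator (by fun_prop) hm).aemeasurable
  have hms : MeasurableSet {x : Ed d | R ≤ ‖x‖} := measurableSet_le (by fun_prop) (by fun_prop)
  calc _ = ∫⁻ x in {x | R ≤ ‖x‖},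
        k * volume (closedBall (0 : Ed d) (1/4)) * (ENNReal.ofReal (u x ^ 2) * G x) := by
        rw [lintegral_const_mul _ (by fun_prop)]
    _ ≤ ∫⁻ x in {x | R ≤ ‖x‖}, (2 * (∫⁻ z in closedBall x 1, ENNReal.ofReal (u z ^ 2) * G z) +
      2 * k * ((∫⁻ y in closedBall x 1, ENNReal.ofReal ((u x - u y) ^ 2)) * G x)) :=
        setLIntegral_mono' hms hpt
    _ ≤ ∫⁻ x, (2 * (∫⁻ z in closedBall x 1, ENNReal.ofReal (u z ^ 2) * G z) +
      2 * k * ((∫⁻ y in closedBall x 1, ENNReal.ofReal ((u x - u y) ^ 2)) * G x)) :=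
        setLIntegral_le_lintegral _ _
    _ = _ := by
        have hE := measurable_setLIntegral_closedBall
          (h := fun q : Ed d × Ed d => ENNReal.ofReal ((u q.1 - u q.2) ^ 2)) (by fun_prop) 1
        have hA := measurable_setLIntegral_closedBall
          (h := fun q : Ed d × Ed d => ENNReal.ofReal (u q.2 ^ 2) * G q.2) (by fun_prop) 1
        rw [lintegral_add_left (by fun_prop), lintegral_const_mul _ hA, hswap,
          lintegral_const_mul _ (by fun_prop)]
        ring

open scoped ENNReal in
lemma lintegral_comp_midpoint {d : ℕ} (x : Ed d) (h : Ed d → ℝ≥0∞) (hh : Measurable h) :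
    ∫⁻ y, h ((1/2 : ℝ) • (x + y)) = 2 ^ d * ∫⁻ y, h y := by
  rw [lintegral_add_left_eq_self (fun y => h ((1/2 : ℝ) • y)) x,
    ← lintegral_map hh (by fun_prop : Measurable fun y : Ed d => (1/2 : ℝ) • y),
    Measure.map_addHaar_smul volume (by norm_num), lintegral_smul_measure]
  simp only [finrank_euclideanSpace, Fintype.card_fin, smul_eq_mul]
  congr 1
  rw [abs_of_pos (by positivity)]
  rw [one_div, inv_pow, inv_inv, ENNReal.ofReal_pow (by norm_num), ENNReal.ofReal_ofNat]

open scoped ENNReal Classical in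
/-- The energy density of `f` between points of `S` at distance at most `s`. -/
def jumpSq {d : ℕ} (S : Set (Ed d)) (f : Ed d → ℝ) (s : ℝ) (q : Ed d × Ed d) : ℝ≥0∞ :=
  if dist q.1 q.2 ≤ s ∧ q.1 ∈ S ∧ q.2 ∈ S then ENNReal.ofReal ((f q.1 - f q.2) ^ 2) else 0

lemma measurable_jumpSq {d : ℕ} {S : Set (Ed d)} (hS : MeasurableSet S) {f : Ed d → ℝ}
    (hf : Measurable f) (s : ℝ) : Measurable (jumpSq S f s) := by
  refine Measurable.ite ?_ (by fun_prop) measurable_const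
  exact (measurableSet_le (f := fun q : Ed d × Ed d => dist q.1 q.2) (by fun_prop)
    measurable_const).inter
    ((measurable_fst hS).inter (measurable_snd hS))

lemma jumpSq_swap {d : ℕ} (S : Set (Ed d)) (f : Ed d → ℝ) (s : ℝ) (x y : Ed d) :
    jumpSq S f s (x, y) = jumpSq S f s (y, x) := by
  simp only [jumpSq]
  rw [show (f x - f y) ^ 2 = (f y - f x) ^ 2 by ring]
  congr 1
  rw [dist_comm, and_comm (a := x ∈ S)]

lemma jumpSq_two_mul_le {d : ℕ} {S : Set (Ed d)} (hS : Convex ℝ S) (f : Ed d → ℝ) (s : ℝ)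
    (x y : Ed d) :
    jumpSq S f (2 * s) (x, y) ≤ 2 * jumpSq S f s (x, (1/2 : ℝ) • (x + y)) +
      2 * jumpSq S f s (y, (1/2 : ℝ) • (y + x)) := by
  by_cases h : dist x y ≤ 2 * s ∧ x ∈ S ∧ y ∈ S
  · obtain ⟨h1, hx, hy⟩ := h
    have hm : (1/2 : ℝ) • (x + y) ∈ S := by
      rw [smul_add]; exact hS hx hy (by norm_num) (by norm_num) (by norm_num)
    have d1 : dist x ((1/2 : ℝ) • (x + y)) ≤ s := by
      rw [dist_eq_norm, show x - (1/2 : ℝ) • (x + y) = (1/2 : ℝ) • (x - y) by module, norm_smul,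
        ← dist_eq_norm]
      norm_num; linarith
    have d2 : dist y ((1/2 : ℝ) • (x + y)) ≤ s := by
      rw [dist_eq_norm, show y - (1/2 : ℝ) • (x + y) = (1/2 : ℝ) • (y - x) by module, norm_smul,
        ← dist_eq_norm, dist_comm]
      norm_num; linarith
    rw [add_comm y x]
    simp only [jumpSq, h1, hx, hy, hm, d1, d2, and_self, if_true]
    exact ofReal_sub_sq_le _ _ _
  · simp [jumpSq, h]

lemma lintegral_jumpSq_two_mul_le {d : ℕ} {S : Set (Ed d)} (hS : Convex ℝ S)
    (hSm : MeasurableSet S) {f : Ed d → ℝ} (hf : Measurable f) (s : ℝ) :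
    ∫⁻ x, ∫⁻ y, jumpSq S f (2 * s) (x, y) ≤ 2 ^ (d + 2) * ∫⁻ x, ∫⁻ y, jumpSq S f s (x, y) := by
  have hW := measurable_jumpSq hSm hf s
  have hA : Measurable fun q : Ed d × Ed d => 2 * jumpSq S f s (q.1, (1/2 : ℝ) • (q.1 + q.2)) := by
    fun_prop
  have hB : Measurable fun q : Ed d × Ed d => 2 * jumpSq S f s (q.2, (1/2 : ℝ) • (q.2 + q.1)) := by
    fun_prop
  have hhalf : ∫⁻ x, ∫⁻ y, 2 * jumpSq S f s (x, (1/2 : ℝ) • (x + y)) =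
      2 ^ (d + 1) * ∫⁻ x, ∫⁻ y, jumpSq S f s (x, y) := by
    rw [← lintegral_const_mul _ hW.lintegral_prod_right']
    refine lintegral_congr fun x => ?_
    rw [lintegral_const_mul _ (by fun_prop),
      lintegral_comp_midpoint x (fun y => jumpSq S f s (x, y)) (by fun_prop)]
    ring
  calc ∫⁻ x, ∫⁻ y, jumpSq S f (2 * s) (x, y)
      ≤ ∫⁻ x, ∫⁻ y, (2 * jumpSq S f s (x, (1/2 : ℝ) • (x + y)) +
          2 * jumpSq S f s (y, (1/2 : ℝ) • (y + x))) :=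
        lintegral_mono fun x => lintegral_mono fun y => jumpSq_two_mul_le hS f s x y
    _ = ∫⁻ x, ((∫⁻ y, 2 * jumpSq S f s (x, (1/2 : ℝ) • (x + y))) +
          ∫⁻ y, 2 * jumpSq S f s (y, (1/2 : ℝ) • (y + x))) :=
        lintegral_congr fun x => lintegral_add_left (by fun_prop) _
    _ = (∫⁻ x, ∫⁻ y, 2 * jumpSq S f s (x, (1/2 : ℝ) • (x + y))) +
          ∫⁻ x, ∫⁻ y, 2 * jumpSq S f s (y, (1/2 : ℝ) • (y + x)) :=
        lintegral_add_left hA.lintegral_prod_right' _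
    _ = _ := by
        rw [lintegral_lintegral_swap (f := fun x y => 2 * jumpSq S f s (y, (1/2 : ℝ) • (y + x)))
          hB.aemeasurable, hhalf]
        ring

lemma lintegral_jumpSq_two_pow_le {d : ℕ} {S : Set (Ed d)} (hS : Convex ℝ S)
    (hSm : MeasurableSet S) {f : Ed d → ℝ} (hf : Measurable f) (n : ℕ) :
    ∫⁻ x, ∫⁻ y, jumpSq S f (2 ^ n) (x, y) ≤
      (2 ^ (d + 2)) ^ n * ∫⁻ x, ∫⁻ y, jumpSq S f 1 (x, y) := by
  induction n with
  | zero => simp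
  | succ n ih =>
    rw [pow_succ' (2 : ℝ), pow_succ' _ n, mul_assoc]
    exact (lintegral_jumpSq_two_mul_le hS hSm hf _).trans (by gcongr)

/-- A Poincaré inequality on balls for jumps of range one. -/
lemma exists_lintegral_ball_le {d : ℕ} (R : ℝ) (hR : 0 < R) (n : ℕ) (hn : 2 * R ≤ 2 ^ n)
    {f : Ed d → ℝ} (hf : Measurable f) :
    ∃ m : ℝ, ∫⁻ y in ball (0 : Ed d) R, ENNReal.ofReal ((f y - m) ^ 2) ≤
      (volume (ball (0 : Ed d) R))⁻¹ * ((2 ^ (d + 2)) ^ n *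
        ∫⁻ x in ball (0 : Ed d) R, ∫⁻ y in closedBall x 1, ENNReal.ofReal ((f x - f y) ^ 2)) := by
  set S := ball (0 : Ed d) R with hS
  have hSm : MeasurableSet S := measurableSet_ball
  have h0 : volume S ≠ 0 := (measure_ball_pos volume _ hR).ne'
  have htop : volume S ≠ ⊤ := measure_ball_lt_top.ne
  have hfull : ∫⁻ x in S, ∫⁻ y in S, ENNReal.ofReal ((f y - f x) ^ 2) =
      ∫⁻ x, ∫⁻ y, jumpSq S f (2 ^ n) (x, y) := by
    rw [← lintegral_indicator hSm]
    refine lintegral_congr fun x => ?_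
    by_cases hx : x ∈ S
    · rw [indicator_of_mem hx, ← lintegral_indicator hSm]
      refine lintegral_congr fun y => ?_
      by_cases hy : y ∈ S
      · have : dist x y ≤ 2 ^ n := by
          have h1 : dist x 0 < R := hx
          have h2 : dist y 0 < R := hy
          linarith [dist_triangle_right x y 0]
        simp [jumpSq, indicator, hx, hy, this, show (f x - f y) ^ 2 = (f y - f x) ^ 2 by ring]
      · simp [jumpSq, indicator, hy]
    · simp [jumpSq, indicator, hx]
  have hone : ∫⁻ x, ∫⁻ y, jumpSq S f 1 (x, y) ≤
      ∫⁻ x in S, ∫⁻ y in closedBall x 1, ENNReal.ofReal ((f x - f y) ^ 2) := by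
    rw [← lintegral_indicator hSm]
    refine lintegral_mono fun x => ?_
    by_cases hx : x ∈ S
    · rw [indicator_of_mem hx, ← lintegral_indicator measurableSet_closedBall]
      refine lintegral_mono fun y => ?_
      by_cases hy : y ∈ S <;> by_cases hd : dist x y ≤ 1 <;>
        simp [jumpSq, indicator, hx, hy, hd, dist_comm y x]
    · simp [jumpSq, indicator, hx]
  have hmeas : Measurable fun x => ∫⁻ y in S, ENNReal.ofReal ((f y - f x) ^ 2) :=
    Measurable.lintegral_prod_right'
      (f := fun q : Ed d × Ed d => ENNReal.ofReal ((f q.2 - f q.1) ^ 2)) (by fun_prop)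
  obtain ⟨x, -, hx⟩ := exists_le_setLAverage h0 htop hmeas.aemeasurable
  refine ⟨f x, hx.trans ?_⟩
  rw [setLAverage_eq, ENNReal.div_eq_inv_mul, hfull]
  gcongr
  exact (lintegral_jumpSq_two_pow_le (convex_ball _ _) hSm hf n).trans (by gcongr)

open scoped ENNReal in
/-- The Poincaré inequality for a density `G` which decays fast enough in the radial direction. -/
lemma exists_lintegral_sub_sq_le {d : ℕ} (G : Ed d → ℝ≥0∞) (hG : Measurable G)
    (k : ℝ≥0∞) (hktop : k ≠ ⊤) (hk4 : 2 * 4 ^ d < k) (R : ℝ) (hR : 1 ≤ R)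
    (hk : ∀ x, R ≤ ‖x‖ → ∀ z, ‖x‖ - 1 ≤ ‖z‖ → ‖z‖ ≤ ‖x‖ - 1/2 → k * G x ≤ G z)
    (gmin gmax : ℝ≥0∞) (hgmin : gmin ≠ 0) (hgmin' : gmin ≠ ⊤) (hgmax : gmax ≠ ⊤)
    (hlow : ∀ x ∈ ball (0 : Ed d) R, gmin ≤ G x) (hupp : ∀ x ∈ ball (0 : Ed d) R, G x ≤ gmax) :
    ∃ C : ℝ≥0∞, C ≠ ⊤ ∧ ∀ f : Ed d → ℝ, Measurable f →
      (∀ m : ℝ, ∫⁻ x, ENNReal.ofReal ((f x - m) ^ 2) * G x ≠ ⊤) →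
      ∃ m : ℝ, ∫⁻ x, ENNReal.ofReal ((f x - m) ^ 2) * G x ≤
        C * ∫⁻ x, (∫⁻ y in closedBall x 1, ENNReal.ofReal ((f x - f y) ^ 2)) * G x := by
  obtain ⟨n, hn⟩ := pow_unbounded_of_one_lt (2 * R) (one_lt_two : (1 : ℝ) < 2)
  set v := volume (ball (0 : Ed d) R) with hv
  set w := volume (closedBall (0 : Ed d) (1/4)) with hw
  have hv0 : v ≠ 0 := (measure_ball_pos volume _ (by linarith)).ne'
  have hw0 : w ≠ 0 := (measure_closedBall_pos volume _ (by norm_num)).ne'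
  have hwtop : w ≠ ⊤ := measure_closedBall_lt_top.ne
  have hvol : volume (closedBall (0 : Ed d) 1) = 4 ^ d * w := by
    have := Measure.addHaar_closedBall_mul (volume : Measure (Ed d)) 0
      (by norm_num : (0 : ℝ) ≤ 4) (by norm_num : (0 : ℝ) ≤ 1/4)
    rw [finrank_euclideanSpace, Fintype.card_fin, ENNReal.ofReal_pow (by norm_num),
      ENNReal.ofReal_ofNat] at this
    rw [← this]
    norm_num
  set Q := gmax * (v⁻¹ * ((2 ^ (d + 2)) ^ n * gmin⁻¹)) with hQ
  set M := w⁻¹ * (2 * k) + k * Q with hM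
  set k' := k - 2 * 4 ^ d with hk'
  have hk'0 : k' ≠ 0 := (tsub_pos_of_lt hk4).ne'
  have hkk : k = 2 * 4 ^ d + k' := (add_tsub_cancel_of_le hk4.le).symm
  have hk'top : k' ≠ ⊤ := ENNReal.sub_ne_top hktop
  have hQtop : Q ≠ ⊤ := by
    refine ENNReal.mul_ne_top hgmax (ENNReal.mul_ne_top (ENNReal.inv_ne_top.2 hv0)
      (ENNReal.mul_ne_top ?_ (ENNReal.inv_ne_top.2 hgmin)))
    exact ENNReal.pow_ne_top (ENNReal.pow_ne_top (by norm_num))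
  have hMtop : M ≠ ⊤ := ENNReal.add_ne_top.2
    ⟨ENNReal.mul_ne_top (ENNReal.inv_ne_top.2 hw0) (ENNReal.mul_ne_top (by norm_num) hktop),
      ENNReal.mul_ne_top hktop hQtop⟩
  refine ⟨k'⁻¹ * M, ENNReal.mul_ne_top (ENNReal.inv_ne_top.2 hk'0) hMtop, fun f hf hfin => ?_⟩
  obtain ⟨m, hm⟩ := exists_lintegral_ball_le (d := d) R (by linarith) n hn.le hf
  refine ⟨m, ?_⟩
  have htail := tail_lintegral_le G hG (fun x => f x - m) (by fun_prop) k R hR hk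
  simp only [sub_sub_sub_cancel_right] at htail
  set E := ∫⁻ x, (∫⁻ y in closedBall x 1, ENNReal.ofReal ((f x - f y) ^ 2)) * G x with hE
  have hT := hfin m
  set T := ∫⁻ x, ENNReal.ofReal ((f x - m) ^ 2) * G x with hTdef
  set A := ∫⁻ x in {x | R ≤ ‖x‖}, ENNReal.ofReal ((f x - m) ^ 2) * G x with hA
  set B := ∫⁻ x in ball (0 : Ed d) R, ENNReal.ofReal ((f x - m) ^ 2) * G x with hB
  have hTAB : T = B + A := by
    rw [hTdef, ← lintegral_add_compl _ (measurableSet_ball (x := (0 : Ed d)) (ε := R))]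
    rw [hA, hB, show {x : Ed d | R ≤ ‖x‖} = (ball 0 R)ᶜ by ext x; simp]
  have henergy : ∫⁻ x in ball (0 : Ed d) R,
      ∫⁻ y in closedBall x 1, ENNReal.ofReal ((f x - f y) ^ 2) ≤ gmin⁻¹ * E := by
    have hmeas := measurable_setLIntegral_closedBall
      (h := fun q : Ed d × Ed d => ENNReal.ofReal ((f q.1 - f q.2) ^ 2)) (by fun_prop) 1
    rw [hE, ← lintegral_const_mul _ (by fun_prop)]
    refine (setLIntegral_mono' measurableSet_ball fun x hx => ?_).trans
      (setLIntegral_le_lintegral (ball (0 : Ed d) R) _)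
    have h1 : 1 ≤ gmin⁻¹ * G x := by
      rw [← ENNReal.inv_mul_cancel hgmin hgmin']
      gcongr
      exact hlow x hx
    calc _ ≤ (∫⁻ y in closedBall x 1, ENNReal.ofReal ((f x - f y) ^ 2)) * (gmin⁻¹ * G x) :=
          le_mul_of_one_le_right' h1
      _ = _ := by ring
  have hBle : B ≤ Q * E := by
    calc B ≤ ∫⁻ x in ball (0 : Ed d) R, gmax * ENNReal.ofReal ((f x - m) ^ 2) := by
          refine setLIntegral_mono' measurableSet_ball fun x hx => ?_
          rw [mul_comm]
          gcongr
          exact hupp x hx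
      _ = gmax * ∫⁻ x in ball (0 : Ed d) R, ENNReal.ofReal ((f x - m) ^ 2) :=
          lintegral_const_mul _ (by fun_prop)
      _ ≤ gmax * (v⁻¹ * ((2 ^ (d + 2)) ^ n * (gmin⁻¹ * E))) := by
          gcongr
          exact hm.trans (by gcongr)
      _ = Q * E := by rw [hQ]; ring
  have hAle : k * A ≤ 2 * 4 ^ d * T + w⁻¹ * (2 * k) * E := by
    calc k * A = w⁻¹ * (k * w * A) := by
          rw [show w⁻¹ * (k * w * A) = (w⁻¹ * w) * (k * A) by ring,
            ENNReal.inv_mul_cancel hw0 hwtop, one_mul]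
      _ ≤ w⁻¹ * (2 * (4 ^ d * w) * T + 2 * k * E) := by
          gcongr
          rw [← hvol]
          exact htail
      _ = (w⁻¹ * w) * (2 * 4 ^ d * T) + w⁻¹ * (2 * k) * E := by ring
      _ = _ := by rw [ENNReal.inv_mul_cancel hw0 hwtop, one_mul]
  have hsum : 2 * 4 ^ d * T + k' * T ≤ 2 * 4 ^ d * T + M * E := by
    calc 2 * 4 ^ d * T + k' * T = k * B + k * A := by rw [← add_mul, ← hkk, hTAB, mul_add]
      _ ≤ k * (Q * E) + (2 * 4 ^ d * T + w⁻¹ * (2 * k) * E) := by gcongr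
      _ = _ := by rw [hM]; ring
  have hfin' : 2 * 4 ^ d * T ≠ ⊤ :=
    ENNReal.mul_ne_top (ENNReal.mul_ne_top (by norm_num) (ENNReal.pow_ne_top (by norm_num))) hT
  have hle : k' * T ≤ M * E := (ENNReal.add_le_add_iff_left hfin').1 hsum
  calc T = k'⁻¹ * (k' * T) := by
        rw [← mul_assoc, ENNReal.inv_mul_cancel hk'0 hk'top, one_mul]
    _ ≤ k'⁻¹ * (M * E) := by gcongr
    _ = k'⁻¹ * M * E := by ring

lemma CbSmooth.exists_abs_le {d : ℕ} {f : Ed d → ℝ} (hf : CbSmooth d f) :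
    ∃ C, ∀ x, |f x| ≤ C := by
  obtain ⟨C, hC⟩ := hf.2 0
  exact ⟨C, fun x => by simpa using hC x⟩

lemma CbSmooth.exists_lipschitz {d : ℕ} {f : Ed d → ℝ} (hf : CbSmooth d f) :
    ∃ L, ∀ x y, |f x - f y| ≤ L * dist x y := by
  obtain ⟨L, hL⟩ := hf.2 1
  refine ⟨L, fun x y => ?_⟩
  rw [dist_eq_norm, ← Real.norm_eq_abs]
  exact convex_univ.norm_image_sub_le_of_norm_fderiv_le
    (fun z _ => (hf.1.differentiable (by simp)).differentiableAt)
    (fun z _ => by simpa only [norm_iteratedFDeriv_one] using hL z) (mem_univ y) (mem_univ x)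

lemma integrable_indicator_norm_rpow {d : ℕ} (hd : 1 ≤ d) {α : ℝ} (hα : α < 2) :
    Integrable fun y : Ed d => (Iic (1 : ℝ)).indicator (fun r : ℝ => r ^ (2 - ((d : ℝ) + α))) ‖y‖ := by
  have : Nonempty (Fin d) := ⟨⟨0, hd⟩⟩
  rw [integrable_fun_norm_addHaar volume
    (f := (Iic (1 : ℝ)).indicator (fun r : ℝ => r ^ (2 - ((d : ℝ) + α))))]
  have h : IntegrableOn (fun y : ℝ => y ^ (1 - α)) (Ioc 0 1) :=
    (integrableOn_Ioc_iff_integrableOn_Ioo).2 <| (intervalIntegral.integrableOn_Ioo_rpow_iff one_pos).2 (by linarith)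
  rw [← integrable_indicator_iff measurableSet_Ioc] at h
  rw [← integrable_indicator_iff measurableSet_Ioi]
  refine h.congr (ae_of_all _ fun y => ?_)
  by_cases h0 : 0 < y
  · by_cases h1 : y ≤ 1
    · simp only [indicator, mem_Ioc, mem_Ioi, mem_Iic, h0, h1, and_self, if_true, smul_eq_mul,
        finrank_euclideanSpace, Fintype.card_fin]
      rw [← Real.rpow_natCast, ← Real.rpow_add h0, Nat.cast_sub hd]
      congr 1
      push_cast
      ring
    · simp [indicator, h1]
  · simp [indicator, h0]

/-- The energy with the singular kernel dominates the one with constant kernel on jumps of size at most one. -/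
lemma lintegral_le_ofReal_formE {d : ℕ} (hd : 1 ≤ d) {α : ℝ} (hα : 0 < α ∧ α < 2) {V f : Ed d → ℝ}
    [IsFiniteMeasure (muV d V)] (hf : CbSmooth d f) :
    ∫⁻ x, (∫⁻ y in closedBall x 1, ENNReal.ofReal ((f x - f y) ^ 2)) ∂(muV d V) ≤
      ENNReal.ofReal (2 * formE d α V f) := by
  obtain ⟨L, hL⟩ := hf.exists_lipschitz
  have hfc : Continuous f := hf.1.continuous
  set J : Ed d → ℝ := fun y =>
    (Iic (1 : ℝ)).indicator (fun r : ℝ => r ^ (2 - ((d : ℝ) + α))) ‖y‖ with hJ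
  have hJint : Integrable J := integrable_indicator_norm_rpow hd hα.2
  set K : Ed d × Ed d → ℝ := {q : Ed d × Ed d | dist q.1 q.2 ≤ 1}.indicator
    (fun q => (f q.1 - f q.2) ^ 2 / dist q.1 q.2 ^ ((d : ℝ) + α)) with hK
  have hKm : StronglyMeasurable K := by
    refine Measurable.stronglyMeasurable (Measurable.indicator ?_ ?_)
    · have := hfc.measurable
      fun_prop
    · exact measurableSet_le (by fun_prop) (by fun_prop)
  have hK0 : ∀ q, 0 ≤ K q := fun q => indicator_nonneg (fun q _ => by positivity) q
  have hKJ : ∀ x y, K (x, y) ≤ L ^ 2 * J (x - y) := by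
    intro x y
    by_cases h : dist x y ≤ 1
    · simp only [hK, hJ, indicator, mem_ofPred_eq, mem_Iic, h, if_true, ← dist_eq_norm]
      rcases (dist_nonneg (x := x) (y := y)).eq_or_lt with h0 | h0
      · rw [dist_eq_zero.1 h0.symm]
        simp only [sub_self, ne_eq, OfNat.ofNat_ne_zero, not_false_eq_true, zero_pow, zero_div]
        positivity
      · rw [Real.rpow_sub h0, Real.rpow_two, ← mul_div_assoc, ← mul_pow]
        exact div_le_div_of_nonneg_right
          (sq_le_sq' (abs_le.1 (hL x y)).1 (abs_le.1 (hL x y)).2) (by positivity)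
    · have h' : ¬ ‖x - y‖ ≤ 1 := by rwa [← dist_eq_norm]
      simp [hK, hJ, indicator, h, h']
  have hKint : ∀ x, Integrable fun y => K (x, y) := by
    intro x
    refine Integrable.mono' ((hJint.comp_sub_left x).const_mul (L ^ 2))
      (hKm.comp_measurable measurable_prodMk_left).aestronglyMeasurable (ae_of_all _ fun y => ?_)
    rw [Real.norm_of_nonneg (hK0 _)]
    exact hKJ x y
  have hinner : ∀ x, ∫ y in {y : Ed d | dist x y ≤ 1}, (f x - f y) ^ 2 / dist x y ^ ((d : ℝ) + α) =
      ∫ y, K (x, y) := by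
    intro x
    rw [← integral_indicator (measurableSet_le (by fun_prop) (by fun_prop))]
    rfl
  have hIint : Integrable (fun x => ∫ y, K (x, y)) (muV d V) := by
    refine Integrable.of_bound (C := L ^ 2 * ∫ y, J y)
      hKm.integral_prod_right'.aestronglyMeasurable (ae_of_all _ fun x => ?_)
    rw [Real.norm_of_nonneg (integral_nonneg fun y => hK0 _)]
    calc ∫ y, K (x, y) ≤ ∫ y, L ^ 2 * J (x - y) :=
          integral_mono (hKint x) ((hJint.comp_sub_left x).const_mul _) (hKJ x)
      _ = _ := by rw [integral_const_mul, integral_sub_left_eq_self J volume x]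
  have hform : 2 * formE d α V f = ∫ x, (∫ y, K (x, y)) ∂(muV d V) := by
    simp only [formE, hinner]
    ring
  rw [hform, ofReal_integral_eq_lintegral_ofReal hIint
    (ae_of_all _ fun x => integral_nonneg fun y => hK0 _)]
  refine lintegral_mono fun x => ?_
  rw [ofReal_integral_eq_lintegral_ofReal (hKint x) (ae_of_all _ fun y => hK0 _),
    ← lintegral_indicator measurableSet_closedBall]
  refine lintegral_mono fun y => ?_
  by_cases h : dist x y ≤ 1
  · simp only [hK, indicator, mem_ofPred_eq, mem_closedBall, dist_comm y x, h, if_true]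
    apply ENNReal.ofReal_le_ofReal
    rcases (dist_nonneg (x := x) (y := y)).eq_or_lt with h0 | h0
    · rw [dist_eq_zero.1 h0.symm]
      simp
    · have hα0 := hα.1
      exact le_div_self (sq_nonneg _) (by positivity)
        (Real.rpow_le_one dist_nonneg h (by positivity))
  · simp [indicator, h, dist_comm y x]

lemma two_pow_lt_of_thresholdConst_lt {d : ℕ} {α c : ℝ} (hα : 0 < α) (hc : thresholdConst d α < c) :
    2 * 4 ^ d < c := by
  refine lt_of_le_of_lt ?_ hc
  have h1 : 1 + Real.log 2 * α ≤ (2 : ℝ) ^ α := by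
    rw [Real.rpow_def_of_pos two_pos, add_comm]
    exact Real.add_one_le_exp _
  have h2 : 0.69 ≤ ((2 : ℝ) ^ α - 1) / α := by
    rw [le_div_iff₀ hα]
    nlinarith [Real.log_two_gt_d9]
  have h3 : 2 ≤ Real.exp 1 + Real.exp (1/2) := by
    linarith [Real.add_one_le_exp 1, Real.exp_pos (1/2)]
  have h4 : 1 ≤ (Real.exp 1 + Real.exp (1/2)) * (((2 : ℝ) ^ α - 1) / α) := by nlinarith
  calc (2 : ℝ) * 4 ^ d = 2 ^ (2 * d + 1) * 1 := by rw [pow_succ, pow_mul]; norm_num; ring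
    _ ≤ 2 ^ (2 * d + 1) * ((Real.exp 1 + Real.exp (1/2)) * (((2 : ℝ) ^ α - 1) / α)) := by gcongr
    _ = _ := by rw [thresholdConst]; ring

/-- The radial ratio condition yields pointwise decay of the density. -/
lemma mul_exp_neg_le_of_le_infAnn_div_supAnn {d : ℕ} {V : Ed d → ℝ} (hV : LocallyBounded d V)
    {c : ℝ} {x z : Ed d} (hc : c ≤ infAnn d V x / supAnn d V x) (h1 : ‖x‖ - 1 ≤ ‖z‖)
    (h2 : ‖z‖ ≤ ‖x‖ - 1/2) (hc0 : 0 ≤ c) : c * Real.exp (-V x) ≤ Real.exp (-V z) := by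
  have hbdd : BddAbove ((fun z => Real.exp (-V z)) '' {z : Ed d | ‖x‖ ≤ ‖z‖ ∧ ‖z‖ ≤ ‖x‖ + 1}) := by
    obtain ⟨M, hM⟩ := hV (‖x‖ + 1)
    refine ⟨Real.exp M, ?_⟩
    rintro _ ⟨y, hy, rfl⟩
    exact Real.exp_le_exp.2 ((neg_le_abs _).trans (hM y hy.2))
  have hsup : Real.exp (-V x) ≤ supAnn d V x :=
    le_csSup hbdd ⟨x, ⟨le_rfl, by linarith⟩, rfl⟩
  have hinf : infAnn d V x ≤ Real.exp (-V z) :=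
    csInf_le ⟨0, by rintro _ ⟨y, -, rfl⟩; positivity⟩ ⟨z, ⟨h1, h2⟩, rfl⟩
  rw [le_div_iff₀ ((Real.exp_pos _).trans_le hsup)] at hc
  exact (mul_le_mul_of_nonneg_left hsup hc0).trans (hc.trans hinf)

/-- Poincaré inequality for the finite-range-jump Dirichlet form
under the liminf condition on `V`. -/
theorem poincare_finite_range_jump
    (d : ℕ) (hd : 1 ≤ d) (α : ℝ) (hα : 0 < α ∧ α < 2)
    (V : Ed d → ℝ) (hVmeas : Measurable V) (hVloc : LocallyBounded d V)
    (hVint : Integrable (fun x => Real.exp (-V x)))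
    (hliminf : ∃ c : ℝ, thresholdConst d α < c ∧
      ∃ R : ℝ, ∀ x : Ed d, R ≤ ‖x‖ → c ≤ infAnn d V x / supAnn d V x) :
    ∃ C₁ : ℝ, 0 < C₁ ∧ ∀ f : Ed d → ℝ, CbSmooth d f →
      (∫ x, f x ∂(muV d V)) = 0 →
      ∫ x, (f x) ^ 2 ∂(muV d V) ≤ C₁ * formE d α V f := by
  obtain ⟨c, hc, R₀, hR₀⟩ := hliminf
  have hc4 := two_pow_lt_of_thresholdConst_lt hα.1 hc
  have hc0 : 0 < c := lt_trans (by positivity) hc4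
  set R := max R₀ 1 with hR
  set a := (∫ y, Real.exp (-V y))⁻¹ with ha
  have ha0 : 0 < a := inv_pos.2 (integral_exp_pos hVint)
  set G : Ed d → ENNReal := fun x => ENNReal.ofReal (a * Real.exp (-V x)) with hGdef
  have hG : Measurable G := by fun_prop
  have hfinite : IsFiniteMeasure (muV d V) :=
    isFiniteMeasure_withDensity_ofReal (hVint.const_mul a).2
  have hmu : ∀ h : Ed d → ENNReal, Measurable h → ∫⁻ x, h x ∂(muV d V) = ∫⁻ x, h x * G x := by
    intro h hh
    rw [muV, lintegral_withDensity_eq_lintegral_mul _ hG hh]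
    simp only [Pi.mul_apply, mul_comm]
  obtain ⟨M, hM⟩ := hVloc R
  have hMb : ∀ x ∈ ball (0 : Ed d) R, |V x| ≤ M := fun x hx => hM x (mem_ball_zero_iff.1 hx).le
  obtain ⟨C, hC, hmain⟩ := exists_lintegral_sub_sq_le G hG (ENNReal.ofReal c) ENNReal.ofReal_ne_top
    (by
      rw [← ENNReal.ofReal_ofNat 2, ← ENNReal.ofReal_ofNat 4, ← ENNReal.ofReal_pow (by norm_num),
        ← ENNReal.ofReal_mul (by norm_num)]
      exact (ENNReal.ofReal_lt_ofReal_iff hc0).2 hc4) R (le_max_right _ _)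
    (fun x hx z h1 h2 => by
      rw [hGdef, ← ENNReal.ofReal_mul hc0.le]
      refine ENNReal.ofReal_le_ofReal ?_
      rw [mul_left_comm]
      gcongr
      exact mul_exp_neg_le_of_le_infAnn_div_supAnn hVloc
        (hR₀ x ((le_max_left _ _).trans hx)) h1 h2 hc0.le)
    (ENNReal.ofReal (a * Real.exp (-M))) (ENNReal.ofReal (a * Real.exp M))
    (ENNReal.ofReal_pos.2 (by positivity)).ne' ENNReal.ofReal_ne_top ENNReal.ofReal_ne_top
    (fun x hx => ENNReal.ofReal_le_ofReal (by gcongr; exact (abs_le.1 (hMb x hx)).2))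
    (fun x hx => ENNReal.ofReal_le_ofReal (by gcongr; exact (neg_le_abs _).trans (hMb x hx)))
  refine ⟨2 * C.toReal + 1, by positivity, fun f hf hf0 => ?_⟩
  have hfm : Measurable f := hf.1.continuous.measurable
  obtain ⟨B, hB⟩ := hf.exists_abs_le
  have hfint : Integrable f (muV d V) :=
    Integrable.of_bound hfm.aestronglyMeasurable B (ae_of_all _ hB)
  have hf2int : Integrable (fun x => f x ^ 2) (muV d V) := by
    refine Integrable.of_bound (C := B ^ 2) (by fun_prop) (ae_of_all _ fun x => ?_)
    rw [norm_pow]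
    exact pow_le_pow_left₀ (norm_nonneg _) (hB x) 2
  have hsub : ∀ m : ℝ, Integrable (fun x => (f x - m) ^ 2) (muV d V) := by
    intro m
    have : (fun x => (f x - m) ^ 2) = fun x => f x ^ 2 - 2 * m * f x + m ^ 2 := by ext; ring
    rw [this]
    exact (hf2int.sub (hfint.const_mul _)).add (integrable_const _)
  have hlint : ∀ m : ℝ, ENNReal.ofReal (∫ x, (f x - m) ^ 2 ∂(muV d V)) =
      ∫⁻ x, ENNReal.ofReal ((f x - m) ^ 2) * G x := by
    intro m
    rw [ofReal_integral_eq_lintegral_ofReal (hsub m) (ae_of_all _ fun x => sq_nonneg _),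
      hmu _ (by fun_prop)]
  have hformE : 0 ≤ formE d α V f := by
    refine mul_nonneg (by norm_num) (integral_nonneg fun x => integral_nonneg fun y => ?_)
    exact div_nonneg (sq_nonneg _) (Real.rpow_nonneg dist_nonneg _)
  obtain ⟨m, hm⟩ := hmain f hfm fun m => hlint m ▸ ENNReal.ofReal_ne_top
  have hmeas := measurable_setLIntegral_closedBall
    (h := fun q : Ed d × Ed d => ENNReal.ofReal ((f q.1 - f q.2) ^ 2)) (by fun_prop) 1
  have hE : ∫⁻ x, (∫⁻ y in closedBall x 1, ENNReal.ofReal ((f x - f y) ^ 2)) * G x ≤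
      ENNReal.ofReal (2 * formE d α V f) :=
    (hmu _ hmeas).symm.trans_le (lintegral_le_ofReal_formE hd hα hf)
  rw [← hlint] at hm
  have hle : ∫ x, (f x - m) ^ 2 ∂(muV d V) ≤ C.toReal * (2 * formE d α V f) := by
    rw [← ENNReal.ofReal_le_ofReal_iff (by positivity), ENNReal.ofReal_mul ENNReal.toReal_nonneg,
      ENNReal.ofReal_toReal hC]
    exact hm.trans (mul_le_mul' le_rfl hE)
  have hvar : ∫ x, f x ^ 2 ∂(muV d V) ≤ ∫ x, (f x - m) ^ 2 ∂(muV d V) := by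
    calc ∫ x, f x ^ 2 ∂(muV d V) = ∫ x, (f x ^ 2 - 2 * m * f x) ∂(muV d V) := by
          rw [integral_sub hf2int (hfint.const_mul (2 * m)), integral_const_mul, hf0, mul_zero, sub_zero]
      _ ≤ ∫ x, (f x - m) ^ 2 ∂(muV d V) := by
          refine integral_mono (hf2int.sub (hfint.const_mul (2 * m))) (hsub m) fun x => ?_
          change f x ^ 2 - 2 * m * f x ≤ (f x - m) ^ 2
          nlinarith [sq_nonneg m]
  linarith
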